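/- Let β̂^{λ₁} be a Lasso solution with parameter λ₁ > 0, ρ̂^{λ₁} = (1/(λ₁n))Xᵀ(y − Xβ̂^{λ₁}), and let β̂^{λ₁,λ₂} be a Bregman Lasso solution with parameters λ₁, λ₂ > 0. Then ‖y − Xβ̂^{λ₁,λ₂}‖₂ ≤ ‖y − Xβ̂^{λ₁}‖₂, i.e. the Bregman Lasso is a refitting of the Lasso. -/

import Mathlib

open MeasureTheory ProbabilityTheory Finset

noncomputable section

/-- Product Gaussian measure `N(0, σ² I_n)` on `ℝⁿ`. -/
def gaussianVec (n : ℕ) (σ : ℝ) : Measure (Fin n → ℝ) :=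
  Measure.pi fun _ => gaussianReal 0 (σ ^ 2).toNNReal

/-- Squared Euclidean norm. -/
def l2sq {m : ℕ} (v : Fin m → ℝ) : ℝ := ∑ i, (v i) ^ 2

/-- Euclidean norm. -/
def l2 {m : ℕ} (v : Fin m → ℝ) : ℝ := Real.sqrt (l2sq v)

/-- ℓ₁ norm. -/
def l1 {m : ℕ} (v : Fin m → ℝ) : ℝ := ∑ i, |v i|

/-- Lasso objective `(1/2n)‖y − Xβ‖₂² + λ‖β‖₁`. -/
def lassoObj {n p : ℕ} (X : Matrix (Fin n) (Fin p) ℝ) (y : Fin n → ℝ) (lam : ℝ)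
    (β : Fin p → ℝ) : ℝ :=
  l2sq (y - X.mulVec β) / (2 * (n : ℝ)) + lam * l1 β

/-- `b` is a Lasso solution with tuning parameter `lam`. -/
def IsLassoSol {n p : ℕ} (X : Matrix (Fin n) (Fin p) ℝ) (y : Fin n → ℝ) (lam : ℝ)
    (b : Fin p → ℝ) : Prop :=
  ∀ β : Fin p → ℝ, lassoObj X y lam b ≤ lassoObj X y lam β

/-- Restricted eigenvalue condition RE(c₀, s) with constant `κ`:
for every `J` with `|J| ≤ s` and every `Δ` with `‖Δ_{Jᶜ}‖₁ ≤ c₀‖Δ_J‖₁`,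
one has `‖XΔ‖₂² ≥ κ² n ‖Δ_J‖₂²`. -/
def RE {n p : ℕ} (X : Matrix (Fin n) (Fin p) ℝ) (c0 : ℝ) (s : ℕ) (κ : ℝ) : Prop :=
  0 < κ ∧ ∀ J : Finset (Fin p), J.card ≤ s → ∀ Δ : Fin p → ℝ,
    (∑ j ∈ Jᶜ, |Δ j|) ≤ c0 * ∑ j ∈ J, |Δ j| →
    κ ^ 2 * ((n : ℝ) * ∑ j ∈ J, (Δ j) ^ 2) ≤ l2sq (X.mulVec Δ)

/-- The Lasso subgradient `ρ̂ = Xᵀ(y − Xβ̂)/(λ n)`. -/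
def lassoSubgrad {n p : ℕ} (X : Matrix (Fin n) (Fin p) ℝ) (y : Fin n → ℝ) (lam : ℝ)
    (b : Fin p → ℝ) : Fin p → ℝ :=
  fun j => (X.transpose.mulVec (y - X.mulVec b)) j / (lam * (n : ℝ))

/-- Boosted Lasso objective `(1/2n)‖y − Xβ‖₂² + λ₂‖β − β̂‖₁`. -/
def boostedObj {n p : ℕ} (X : Matrix (Fin n) (Fin p) ℝ) (y : Fin n → ℝ) (lam2 : ℝ)
    (bhat β : Fin p → ℝ) : ℝ :=
  l2sq (y - X.mulVec β) / (2 * (n : ℝ)) + lam2 * l1 (β - bhat)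

/-- `b` is a Boosted Lasso solution built upon the first-step estimator `bhat`. -/
def IsBoostedSol {n p : ℕ} (X : Matrix (Fin n) (Fin p) ℝ) (y : Fin n → ℝ) (lam2 : ℝ)
    (bhat b : Fin p → ℝ) : Prop :=
  ∀ β : Fin p → ℝ, boostedObj X y lam2 bhat b ≤ boostedObj X y lam2 bhat β

/-- Bregman Lasso objective
`(1/2n)‖y − Xβ‖₂² + λ₂(‖β‖₁ − ⟨ρ̂^{λ₁}, β⟩)` where `ρ̂^{λ₁}` is the
Lasso subgradient associated with `bhat`. -/
def bregmanObj {n p : ℕ} (X : Matrix (Fin n) (Fin p) ℝ) (y : Fin n → ℝ) (lam1 lam2 : ℝ)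
    (bhat β : Fin p → ℝ) : ℝ :=
  l2sq (y - X.mulVec β) / (2 * (n : ℝ)) +
    lam2 * (l1 β - ∑ j, lassoSubgrad X y lam1 bhat j * β j)

/-- `b` is a Bregman Lasso solution with parameters `(lam1, lam2)`. -/
def IsBregmanSol {n p : ℕ} (X : Matrix (Fin n) (Fin p) ℝ) (y : Fin n → ℝ) (lam1 lam2 : ℝ)
    (bhat b : Fin p → ℝ) : Prop :=
  ∀ β : Fin p → ℝ, bregmanObj X y lam1 lam2 bhat b ≤ bregmanObj X y lam1 lam2 bhat β

/-- `bbar` is a sign-consistent refitting of the Lasso solution `bhat`: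
it does not increase the residual norm and `(1/n)Xᵀ(y − Xβ̂) ∈ λ·sign(β̄)`
componentwise. -/
def SignConsistentRefit {n p : ℕ} (X : Matrix (Fin n) (Fin p) ℝ) (y : Fin n → ℝ) (lam : ℝ)
    (bhat bbar : Fin p → ℝ) : Prop :=
  l2 (y - X.mulVec bbar) ≤ l2 (y - X.mulVec bhat) ∧
  ∀ j, (0 < bbar j → X.transpose.mulVec (y - X.mulVec bhat) j / (n : ℝ) = lam) ∧
       (bbar j < 0 → X.transpose.mulVec (y - X.mulVec bhat) j / (n : ℝ) = -lam) ∧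
       (bbar j = 0 → |X.transpose.mulVec (y - X.mulVec bhat) j / (n : ℝ)| ≤ lam)

/-- `bbar` is a Sign-Least-Squares Lasso refitting of the Lasso solution `bhat`:
it vanishes outside the equicorrelation set `E = {j : |ρ̂_j| = 1}` and minimizes
the residual sum of squares among all vectors supported on `E` whose coordinates
have signs compatible with `ρ̂_E`. -/
def IsSLSSol {n p : ℕ} (X : Matrix (Fin n) (Fin p) ℝ) (y : Fin n → ℝ) (lam : ℝ)
    (bhat bbar : Fin p → ℝ) : Prop :=
  (∀ j, |lassoSubgrad X y lam bhat j| ≠ 1 → bbar j = 0) ∧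
  (∀ j, 0 ≤ lassoSubgrad X y lam bhat j * bbar j) ∧
  ∀ β : Fin p → ℝ,
    ((∀ j, |lassoSubgrad X y lam bhat j| ≠ 1 → β j = 0) ∧
     (∀ j, 0 ≤ lassoSubgrad X y lam bhat j * β j)) →
    l2sq (y - X.mulVec bbar) ≤ l2sq (y - X.mulVec β)

/-- Componentwise soft-thresholding operator `softThresh(y, λ)_j = sign(y_j)(|y_j| − λ)₊`. -/
def softThresh {p : ℕ} (y : Fin p → ℝ) (lam : ℝ) : Fin p → ℝ :=
  fun j => Real.sign (y j) * max (|y j| - lam) 0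

/-- Componentwise firm-thresholding (MCP) operator. -/
def MCP {p : ℕ} (y : Fin p → ℝ) (μ γ : ℝ) : Fin p → ℝ :=
  fun j => if |y j| ≤ μ * γ then γ / (γ - 1) * (Real.sign (y j) * max (|y j| - μ) 0) else y j

/-- Bregman objective in the denoising (orthogonal, `X = I_p`) case:
`(1/2)‖y − β‖₂² + λ(‖β‖₁ − ⟨ρ, β⟩)`. -/
def denoiseBregObj {p : ℕ} (y ρ : Fin p → ℝ) (lam : ℝ) (β : Fin p → ℝ) : ℝ :=
  (1 / 2) * l2sq (y - β) + lam * (l1 β - ∑ j, ρ j * β j)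

end

lemma l2sq_sub_smul {m : ℕ} (r v : Fin m → ℝ) (t : ℝ) :
    l2sq (r - t • v) = l2sq r - 2 * t * (r ⬝ᵥ v) + t ^ 2 * l2sq v := by
  simp only [l2sq, dotProduct, Finset.mul_sum, ← Finset.sum_sub_distrib, ← Finset.sum_add_distrib]
  refine Finset.sum_congr rfl fun i _ => ?_
  simp only [Pi.sub_apply, Pi.smul_apply, smul_eq_mul]
  ring

lemma l2sq_nonneg {m : ℕ} (v : Fin m → ℝ) : 0 ≤ l2sq v :=
  Finset.sum_nonneg fun _ _ => sq_nonneg _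

lemma l1_add_smul_sub_le {m : ℕ} (u v : Fin m → ℝ) {t : ℝ} (ht₀ : 0 ≤ t) (ht₁ : t ≤ 1) :
    l1 (u + t • (v - u)) ≤ (1 - t) * l1 u + t * l1 v := by
  simp only [l1, Finset.mul_sum, ← Finset.sum_add_distrib]
  refine Finset.sum_le_sum fun i _ => ?_
  calc |(u + t • (v - u)) i| = |(1 - t) * u i + t * v i| := by
        simp only [Pi.add_apply, Pi.smul_apply, Pi.sub_apply, smul_eq_mul]
        ring_nf
    _ ≤ |(1 - t) * u i| + |t * v i| := abs_add_le _ _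
    _ = (1 - t) * |u i| + t * |v i| := by
        rw [abs_mul, abs_mul, abs_of_nonneg ht₀, abs_of_nonneg (sub_nonneg.2 ht₁)]

lemma nonpos_of_forall_le_mul {a c : ℝ} (hc : 0 ≤ c)
    (h : ∀ t : ℝ, 0 < t → t ≤ 1 → a ≤ t * c) : a ≤ 0 := by
  by_contra! ha
  have hac : 0 < a + c := by linarith
  have := h (a / (a + c)) (by positivity) ((div_le_one hac).2 (by linarith))
  rw [div_mul_eq_mul_div, le_div_iff₀ hac] at this
  nlinarith

lemma sum_lassoSubgrad_mul {n p : ℕ} (X : Matrix (Fin n) (Fin p) ℝ) (y : Fin n → ℝ) (lam : ℝ)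
    (b d : Fin p → ℝ) :
    ∑ j, lassoSubgrad X y lam b j * d j =
      ((y - X.mulVec b) ⬝ᵥ X.mulVec d) / (lam * (n : ℝ)) := by
  rw [Matrix.dotProduct_mulVec, ← Matrix.mulVec_transpose, dotProduct, Finset.sum_div]
  refine Finset.sum_congr rfl fun j _ => ?_
  rw [lassoSubgrad, div_mul_eq_mul_div]

/-- The vector `lassoSubgrad X y lam b` is a subgradient of the ℓ₁ norm at a Lasso solution `b`. -/
lemma IsLassoSol.l1_sub_le {n p : ℕ} (hn : 0 < n) {X : Matrix (Fin n) (Fin p) ℝ}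
    {y : Fin n → ℝ} {lam : ℝ} (hlam : 0 < lam) {b : Fin p → ℝ} (hb : IsLassoSol X y lam b)
    (β : Fin p → ℝ) :
    l1 b - ∑ j, lassoSubgrad X y lam b j * b j ≤
      l1 β - ∑ j, lassoSubgrad X y lam b j * β j := by
  have hn' : (0 : ℝ) < n := Nat.cast_pos.2 hn
  set r := y - X.mulVec b with hr
  set d := β - b with hd
  have key : r ⬝ᵥ X.mulVec d / n - lam * (l1 β - l1 b) ≤ 0 := by
    refine nonpos_of_forall_le_mul (c := l2sq (X.mulVec d) / (2 * n))
      (div_nonneg (l2sq_nonneg _) (by positivity)) fun t ht₀ ht₁ => ?_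
    have hmin := hb (b + t • d)
    have hres : y - X.mulVec (b + t • d) = r - t • X.mulVec d := by
      rw [Matrix.mulVec_add, Matrix.mulVec_smul, hr, sub_add_eq_sub_sub]
    rw [lassoObj, lassoObj, hres, l2sq_sub_smul, ← hr] at hmin
    have hl1 := mul_le_mul_of_nonneg_left (l1_add_smul_sub_le b β ht₀.le ht₁) hlam.le
    have hsplit : (l2sq r - 2 * t * (r ⬝ᵥ X.mulVec d) + t ^ 2 * l2sq (X.mulVec d)) / (2 * n) =
        l2sq r / (2 * n) - t * (r ⬝ᵥ X.mulVec d / n) +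
          t * (t * (l2sq (X.mulVec d) / (2 * n))) := by
      field_simp
    rw [hsplit] at hmin
    refine le_of_mul_le_mul_left ?_ ht₀
    linarith
  have hsum : ∑ j, lassoSubgrad X y lam b j * β j - ∑ j, lassoSubgrad X y lam b j * b j =
      r ⬝ᵥ X.mulVec d / n / lam := by
    rw [div_div, mul_comm (n : ℝ), ← sum_lassoSubgrad_mul, ← Finset.sum_sub_distrib]
    simp only [hd, Pi.sub_apply, mul_sub]
  have : r ⬝ᵥ X.mulVec d / n / lam ≤ l1 β - l1 b := by
    rw [div_le_iff₀ hlam]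
    linarith
  linarith

theorem stmt10 (n p : ℕ) (hn : 0 < n) (hp : 0 < p)
    (X : Matrix (Fin n) (Fin p) ℝ) (y : Fin n → ℝ)
    (lam1 lam2 : ℝ) (hlam1 : 0 < lam1) (hlam2 : 0 < lam2)
    (bhat : Fin p → ℝ) (hb : IsLassoSol X y lam1 bhat)
    (bb : Fin p → ℝ) (hbb : IsBregmanSol X y lam1 lam2 bhat bb) :
    l2 (y - X.mulVec bb) ≤ l2 (y - X.mulVec bhat) := by
  refine Real.sqrt_le_sqrt ?_
  have hsub := mul_le_mul_of_nonneg_left (hb.l1_sub_le hn hlam1 bb) hlam2.le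
  have hmin := hbb bhat
  rw [bregmanObj, bregmanObj] at hmin
  have hn' : (0 : ℝ) < 2 * n := by positivity
  refine (div_le_div_iff_of_pos_right hn').1 ?_
  linarith
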